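/- Let T be a string, let U = T[i..j] be a fragment of T of length u = j-i+1, and let k ≥ 0 be an integer. Then the number of runs R = T[a..b] of T with per(R) ≤ 2^k/3 and |[a..b] ∩ [i..j]| ≥ 2^k (i.e., runs whose overlap with U has length at least 2^k) is at most 3u/2^k. -/

import Mathlib

/-- `p` is a period of the fragment `S[a..b]` (1-indexed, inclusive). -/
def FragPeriod {α : Type*} (S : ℕ → α) (a b p : ℕ) : Prop :=
  1 ≤ p ∧ p ≤ b + 1 - a ∧ ∀ x, a ≤ x → x + p ≤ b → S x = S (x + p)

/-- `T[a..b]` is a run of the string `T` of length `n` with smallest period `p`. -/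
def IsRunWith {α : Type*} (T : ℕ → α) (n a b p : ℕ) : Prop :=
  1 ≤ a ∧ a ≤ b ∧ b ≤ n ∧
  IsLeast {q | FragPeriod T a b q} p ∧
  2 * p ≤ b + 1 - a ∧
  (1 < a → T (a - 1) ≠ T (a + p - 1)) ∧
  (b < n → T (b - p + 1) ≠ T (b + 1))

/-- Positions of a periodic fragment that are congruent modulo the period carry equal letters. -/
theorem FragPeriod.eq_of_modEq {α : Type*} {S : ℕ → α} {a b p x y : ℕ} (h : FragPeriod S a b p)
    (hax : a ≤ x) (hxb : x ≤ b) (hay : a ≤ y) (hyb : y ≤ b) (hxy : x ≡ y [MOD p]) :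
    S x = S y := by
  have step : ∀ m z, a ≤ z → z + m * p ≤ b → S z = S (z + m * p) := by
    intro m
    induction m with
    | zero => simp
    | succ m ih =>
      intro z haz hz
      have hm : z + (m + 1) * p = z + m * p + p := by ring
      rw [hm] at hz ⊢
      rw [ih z haz (by omega)]
      exact h.2.2 _ (by omega) hz
  have ordered : ∀ x y, a ≤ x → y ≤ b → x ≤ y → x ≡ y [MOD p] → S x = S y := by
    intro x y hax hyb hle hxy
    obtain ⟨m, hm⟩ := (Nat.modEq_iff_dvd' hle).1 hxy
    have hy : y = x + m * p := by rw [mul_comm, ← hm]; omega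
    rw [hy]
    exact step m x hax (by omega)
  rcases le_total x y with hle | hle
  · exact ordered x y hax hyb hle hxy
  · exact (ordered y x hay hxb hle hxy.symm).symm

theorem exists_modEq_mem_Ico (c x : ℕ) {p : ℕ} (hp : 1 ≤ p) :
    ∃ y, c ≤ y ∧ y < c + p ∧ x ≡ y [MOD p] := by
  refine ⟨c + (x + c * (p - 1)) % p, by omega,
    Nat.add_lt_add_left (Nat.mod_lt _ hp) c, Nat.ModEq.symm ?_⟩
  have h₁ : c + (x + c * (p - 1)) % p ≡ c + (x + c * (p - 1)) [MOD p] :=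
    (Nat.mod_modEq _ p).add_left c
  have h₂ : c + (x + c * (p - 1)) = x + c * p := by
    obtain ⟨r, rfl⟩ := Nat.exists_eq_add_of_le' hp
    simp only [Nat.add_sub_cancel]
    ring
  rw [h₂] at h₁
  exact h₁.trans (by simp [Nat.ModEq])

/-- If a `p`-periodic fragment contains a `q`-periodic one of length at least `p + q`,
then the whole fragment is `q`-periodic. -/
theorem FragPeriod.extend {α : Type*} {S : ℕ → α} {a b c d p q : ℕ} (hp : FragPeriod S a b p)
    (hq : FragPeriod S c d q) (hac : a ≤ c) (hdb : d ≤ b) (hlen : c + p + q ≤ d + 1) :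
    FragPeriod S a b q := by
  refine ⟨hq.1, by omega, fun x hax hxb => ?_⟩
  obtain ⟨y, hcy, hyp, hxy⟩ := exists_modEq_mem_Ico c x hp.1
  calc S x = S y := hp.eq_of_modEq hax (by omega) (by omega) (by omega) hxy
    _ = S (y + q) := hq.2.2 y hcy (by omega)
    _ = S (x + q) :=
      hp.eq_of_modEq (by omega) (by omega) (by omega) hxb (hxy.symm.add_right q)

theorem FragPeriod.mono {α : Type*} {S : ℕ → α} {a b c d p : ℕ} (h : FragPeriod S a b p)
    (hac : a ≤ c) (hdb : d ≤ b) (hlen : p ≤ d + 1 - c) : FragPeriod S c d p :=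
  ⟨h.1, hlen, fun x hcx hxd => h.2.2 x (by omega) (by omega)⟩

/-- Two runs whose overlap is at least the sum of their periods coincide. -/
theorem IsRunWith.eq_of_overlap {α : Type*} {T : ℕ → α} {n a b p a' b' p' c d : ℕ}
    (h : IsRunWith T n a b p) (h' : IsRunWith T n a' b' p') (hac : a ≤ c) (hac' : a' ≤ c)
    (hdb : d ≤ b) (hdb' : d ≤ b') (hlen : c + p + p' ≤ d + 1) : a = a' ∧ b = b' := by
  obtain ⟨ha, -, hbn, ⟨hper, hmin⟩, -, hleft, hright⟩ := h
  obtain ⟨ha', -, hbn', ⟨hper', hmin'⟩, -, hleft', hright'⟩ := h'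
  simp only [Set.mem_ofPred_eq] at hper hper'
  have hle : p ≤ p' :=
    hmin (hper.extend (hper'.mono hac' hdb' (by omega)) hac hdb hlen)
  have hge : p' ≤ p :=
    hmin' (hper'.extend (hper.mono hac hdb (by omega)) hac' hdb' (by omega))
  obtain rfl : p = p' := le_antisymm hle hge
  have hp : 1 ≤ p := hper.1
  constructor
  · rcases lt_trichotomy a a' with hlt | heq | hlt
    · refine absurd ?_ (hleft' (by omega))
      rw [hper.2.2 (a' - 1) (by omega) (by omega)]
      congr 1
      omega
    · exact heq
    · refine absurd ?_ (hleft (by omega))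
      rw [hper'.2.2 (a - 1) (by omega) (by omega)]
      congr 1
      omega
  · rcases lt_trichotomy b b' with hlt | heq | hlt
    · refine absurd ?_ (hright (by omega))
      rw [hper'.2.2 (b - p + 1) (by omega) (by omega)]
      congr 1
      omega
    · exact heq
    · refine absurd ?_ (hright' (by omega))
      rw [hper.2.2 (b' - p + 1) (by omega) (by omega)]
      congr 1
      omega

/-- The number of runs `R = T[a..b]` of `T` with `per(R) ≤ 2^k/3` (i.e. `3·per(R) ≤ 2^k`)
whose overlap with a fragment `U = T[i..j]` of length `u` has length at least `2^k`
is at most `3u/2^k`. -/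
theorem statement7 {α : Type*} (T : ℕ → α) (n i j u k : ℕ)
    (hi : 1 ≤ i) (hij : i ≤ j) (hj : j ≤ n) (hu : u = j + 1 - i) :
    {q : ℕ × ℕ | ∃ p, IsRunWith T n q.1 q.2 p ∧ 3 * p ≤ 2 ^ k ∧
        2 ^ k ≤ (Finset.Icc q.1 q.2 ∩ Finset.Icc i j).card}.ncard * 2 ^ k
      ≤ 3 * u := by
  have hL : 0 < 2 ^ k := by positivity
  generalize 2 ^ k = L at hL ⊢
  have card_inter (a b : ℕ) :
      (Finset.Icc a b ∩ Finset.Icc i j).card = min b j + 1 - max a i := by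
    rw [← Nat.card_Icc]
    congr 1
    ext x
    simp only [Finset.mem_inter, Finset.mem_Icc]
    omega
  simp only [card_inter]
  refine le_trans (Nat.mul_le_mul_right L ?_) (Nat.div_mul_le_self (3 * u) L)
  rw [← Finset.card_range (3 * u / L), ← Set.ncard_coe_finset]
  refine Set.ncard_le_ncard_of_injOn (fun q => 3 * (max q.1 i - i) / L) ?_ ?_ (Finset.finite_toSet _)
  · rintro ⟨a, b⟩ ⟨p, -, -, hov⟩
    simp only [Finset.coe_range, Set.mem_Iio] at hov ⊢
    rw [← Nat.succ_le_iff, Nat.succ_eq_add_one, ← Nat.add_div_right _ hL]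
    exact Nat.div_le_div_right (by omega)
  · rintro ⟨a, b⟩ ⟨p, hrun, hp, hov⟩ ⟨a', b'⟩ ⟨p', hrun', hp', hov'⟩ heq
    simp only at hrun hrun' hov hov' heq
    have h₁ := Nat.div_add_mod (3 * (max a i - i)) L
    have h₂ := Nat.div_add_mod (3 * (max a' i - i)) L
    have h₃ := Nat.mod_lt (3 * (max a i - i)) hL
    have h₄ := Nat.mod_lt (3 * (max a' i - i)) hL
    rw [← heq] at h₂
    obtain ⟨rfl, rfl⟩ := hrun.eq_of_overlap hrun' (c := max (max a i) (max a' i))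
      (d := min (min b j) (min b' j)) (by omega) (by omega) (by omega) (by omega) (by omega)
    rfl
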